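/- The map t ↦ Φ_t^{312} is a bijection from the set 𝔗_{n+1} of rooted ordered trees with n+1 vertices to the set Av_n(312) of permutations of [n] avoiding 312, where for t ∈ 𝔗_{n+1} with vertices v_0, v_1, …, v_n listed in increasing lexicographic order and w_i = v_{n+1−i}, Φ_t^{312}(i) = i − |t_{w_i}| + |w_i| for i = 1, …, n, with t_{w_i} the fringe subtree of t at w_i and |w_i| the height of w_i. -/

import Mathlib

open Set Filter MeasureTheory Topology TopologicalSpace
open scoped ENNReal

namespace AvoidPaper

/-- Instances for the codomain `ℕ∞` (one-point compactification of `ℕ`). -/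
instance : SecondCountableTopology ℕ∞ := by
  have h : ({s : Set ℕ∞ | ∃ a, s = Set.Ioi a ∨ s = Set.Iio a}).Countable := by
    have hsub : {s : Set ℕ∞ | ∃ a, s = Set.Ioi a ∨ s = Set.Iio a}
        ⊆ Set.range (Set.Ioi : ℕ∞ → Set ℕ∞) ∪ Set.range (Set.Iio : ℕ∞ → Set ℕ∞) := by
      rintro s ⟨a, rfl | rfl⟩
      · exact Or.inl ⟨a, rfl⟩
      · exact Or.inr ⟨a, rfl⟩
    exact ((Set.countable_range _).union (Set.countable_range _)).mono hsub
  exact SecondCountableTopology.mk' h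

instance : OpensMeasurableSpace ℕ∞ := ⟨le_top⟩

/-! ## Ulam–Harris vertices and rooted ordered trees -/

/-- A vertex of the Ulam–Harris tree: a finite list of natural numbers (children indices),
ordered lexicographically (so an ancestor precedes its descendants). -/
abbrev Vertex : Type := List ℕ

/-- A (rooted ordered) tree: contains the root, is closed under ancestors, and is
left-closed among siblings. -/
def IsTree (t : Set Vertex) : Prop :=
  ([] : Vertex) ∈ t ∧ (∀ u v : Vertex, u ++ v ∈ t → u ∈ t) ∧
    ∀ (u : Vertex) (i j : ℕ), u ++ [i] ∈ t → j ≤ i → u ++ [j] ∈ t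

/-- The set of children indices of `u` in `t`. -/
def children (t : Set Vertex) (u : Vertex) : Set ℕ := {i | u ++ [i] ∈ t}

/-- Locally finite tree. -/
def LocFin (t : Set Vertex) : Prop := ∀ u : Vertex, (children t u).Finite

/-- Number of children of `u` in `t`. -/
noncomputable def childCount (t : Set Vertex) (u : Vertex) : ℕ := (children t u).ncard

/-- The degree function `d_t(u)`: number of children, and `-1` if `u ∉ t`. -/
noncomputable def deg (t : Set Vertex) (u : Vertex) : ℤ :=
  haveI := Classical.dec (u ∈ t)
  if u ∈ t then (childCount t u : ℤ) else -1

/-- `t^[m]`: restriction of `t` to the vertices of height at most `m`. -/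
def trunc (t : Set Vertex) (m : ℕ) : Set Vertex := {u ∈ t | u.length ≤ m}

/-- Local convergence of trees: `d_{t_n}(u) → d_t(u)` for every vertex `u`
(equivalently, eventual equality, since degrees are integers). -/
def LocalConv (ts : ℕ → Set Vertex) (t : Set Vertex) : Prop :=
  ∀ u : Vertex, ∀ᶠ n in atTop, deg (ts n) u = deg t u

/-- A leaf: a vertex of `t` with no children. -/
def IsLeaf (t : Set Vertex) (v : Vertex) : Prop := v ∈ t ∧ ∀ i : ℕ, v ++ [i] ∉ t

def leafSet (t : Set Vertex) : Set Vertex := {v | IsLeaf t v}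

/-- The fringe subtree `t_v` of `t` at `v` (as a subset of `t`). -/
def fringe (t : Set Vertex) (v : Vertex) : Set Vertex := {x ∈ t | v <+: x}

/-- Number of vertices of `t` at height exactly `k`. -/
noncomputable def levelCount (t : Set Vertex) (k : ℕ) : ℕ := {u ∈ t | u.length = k}.ncard

/-- An infinite spine of `t`: `η 0` is the root and `η (i+1)` is a child of `η i`. -/
def IsSpine (t : Set Vertex) (η : ℕ → Vertex) : Prop :=
  η 0 = [] ∧ (∀ i, η i ∈ t) ∧ ∀ i, ∃ c : ℕ, η (i + 1) = η i ++ [c]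

/-- `v` lies strictly to the left of the spine `η`. -/
def LeftOfSpine (t : Set Vertex) (η : ℕ → Vertex) (v : Vertex) : Prop :=
  v ∈ t ∧ (∀ i, η i ≠ v) ∧ ∃ j, v < η j

/-- `v` lies strictly to the right of the spine `η`. -/
def RightOfSpine (t : Set Vertex) (η : ℕ → Vertex) (v : Vertex) : Prop :=
  v ∈ t ∧ ∀ j, η j < v

/-- `η` is the unique infinite spine of `t`, with infinitely many subtrees attached to
the left and to the right of the spine, infinitely many of the left ones having at
least two vertices. -/
def SpineSpec (t : Set Vertex) (η : ℕ → Vertex) : Prop :=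
  IsSpine t η ∧ (∀ η', IsSpine t η' → η' = η) ∧
  {u : Vertex | (∃ k c, u = η k ++ [c]) ∧ LeftOfSpine t η u}.Infinite ∧
  {u : Vertex | (∃ k c, u = η k ++ [c]) ∧ RightOfSpine t η u}.Infinite ∧
  {u : Vertex | (∃ k c, u = η k ++ [c]) ∧ LeftOfSpine t η u ∧
      2 ≤ (fringe t u).encard}.Infinite

/-- `𝔗_f`: finite trees with at least two vertices. -/
def MemTf (t : Set Vertex) : Prop := IsTree t ∧ t.Finite ∧ 2 ≤ t.encard

/-- `𝔗_∞`. -/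
def MemTinf (t : Set Vertex) : Prop :=
  IsTree t ∧ LocFin t ∧ t.Infinite ∧ ∃ η : ℕ → Vertex, SpineSpec t η

/-- The leaves of `t` lying to the left of the spine `η`. -/
def leftLeaves (t : Set Vertex) (η : ℕ → Vertex) : Set Vertex :=
  {x | IsLeaf t x ∧ LeftOfSpine t η x}

/-- `v` is the enumeration `(v_{t,i})` of (an initial part of) `t` in increasing
lexicographic order: `v i ∈ t` and the vertices of `t` smaller than `v i` are
exactly `v 0, …, v (i-1)`. -/
def IsLexEnum (t : Set Vertex) (v : ℕ → Vertex) : Prop :=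
  ∀ i : ℕ, (i : ℕ∞) < t.encard →
    v i ∈ t ∧ {x ∈ t | x < v i} = v '' {j | j < i}

/-- `w` is the enumeration `(w_{t,i})` of (a final part of) `t` in decreasing
lexicographic order, starting from the lexicographically largest vertex. -/
def IsLexCoEnum (t : Set Vertex) (w : ℕ → Vertex) : Prop :=
  ∀ i : ℕ, (i : ℕ∞) < t.encard →
    w i ∈ t ∧ {x ∈ t | w i < x} = w '' {j | j < i}

/-- `l` enumerates the set `A` in increasing lexicographic order. -/
def IsEnumOf (A : Set Vertex) (l : ℕ → Vertex) : Prop :=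
  ∀ i : ℕ, (i : ℕ∞) < A.encard →
    l i ∈ A ∧ {x ∈ A | x < l i} = l '' {j | j < i}

/-- `s_i`: the number of vertices of `t` lexicographically smaller than the `i`-th leaf
(0-indexed: `l 0` is the paper's `l_1`). -/
noncomputable def sVal (t : Set Vertex) (l : ℕ → Vertex) (i : ℕ) : ℕ :=
  {x ∈ t | x < l i}.ncard

/-- `p_i`: the height of the `i`-th leaf. -/
def pVal (l : ℕ → Vertex) (i : ℕ) : ℕ := (l i).length

/-! ## The maps Φ^σ -/

/-- `Φ^{231}` as an element of `F(ℕ, ℕ*)` (value `i` outside the range of indices). -/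
noncomputable def phi231 (t : Set Vertex) (v : ℕ → Vertex) : ℕ → ℕ∞ := fun i =>
  if 1 ≤ i ∧ (i : ℕ∞) < t.encard then
    ((i : ℕ∞) + (fringe t (v i)).encard) - ((v i).length : ℕ∞)
  else (i : ℕ∞)

noncomputable def phi213 (t : Set Vertex) (v : ℕ → Vertex) : ℕ → ℕ∞ := fun i =>
  if 1 ≤ i ∧ (i : ℕ∞) < t.encard then
    ((t \ fringe t (v i)).encard + ((v i).length : ℕ∞)) - (i : ℕ∞)
  else (i : ℕ∞)

noncomputable def phi312 (t : Set Vertex) (w : ℕ → Vertex) : ℕ → ℕ∞ := fun i =>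
  if 1 ≤ i ∧ (i : ℕ∞) < t.encard then
    ((i : ℕ∞) + ((w (i - 1)).length : ℕ∞)) - (fringe t (w (i - 1))).encard
  else (i : ℕ∞)

noncomputable def phi132 (t : Set Vertex) (w : ℕ → Vertex) : ℕ → ℕ∞ := fun i =>
  if 1 ≤ i ∧ (i : ℕ∞) < t.encard then
    ((t.encard + (fringe t (w (i - 1))).encard) - (i : ℕ∞)) - ((w (i - 1)).length : ℕ∞)
  else (i : ℕ∞)

/-- `B = {s_i - p_i + 1 : i}` (with `i` ranging over indices `< L` of leaves). -/
def Bset (S P : ℕ → ℕ) (L : ℕ∞) : Set ℕ :=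
  {b | ∃ i : ℕ, (i : ℕ∞) < L ∧ S i - P i + 1 = b}

/-- `A = {s_i : i}`. -/
def Aset (S : ℕ → ℕ) (L : ℕ∞) : Set ℕ := {a | ∃ i : ℕ, (i : ℕ∞) < L ∧ S i = a}

/-- The number of elements of `C` in `{1, …, j}`. -/
noncomputable def rankIn (C : Set ℕ) (j : ℕ) : ℕ := (C ∩ Set.Icc 1 j).ncard

/-- The `a`-th smallest positive element of `C`. -/
noncomputable def nthOf (C : Set ℕ) (a : ℕ) : ℕ :=
  sInf {m : ℕ | a ≤ (C ∩ Set.Icc 1 m).ncard}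

open Classical in
/-- `Φ^{321}` built from the data `s, p` (and the number `L` of leaves):
`s_i - p_i + 1 ↦ s_i`, extended by the unique increasing bijection between the
complements (and by the identity outside `[1, n]` in the finite case). -/
noncomputable def phi321Fun (S P : ℕ → ℕ) (L : ℕ∞) : ℕ → ℕ∞ := fun j =>
  if h : j ∈ Bset S P L then (S h.choose : ℕ∞)
  else (nthOf (Aset S L)ᶜ (rankIn (Bset S P L)ᶜ j) : ℕ∞)

/-- `Φ^{123} = |t| + 1 - Φ^{321}` as an element of `F(ℕ, ℕ*)`. -/
noncomputable def phi123Fun (tc : ℕ∞) (f : ℕ → ℕ∞) : ℕ → ℕ∞ := fun j =>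
  if 1 ≤ j ∧ (j : ℕ∞) < tc then (tc + 1) - f j else (j : ℕ∞)

/-! ## Patterns and pattern avoidance -/

def p123 : Equiv.Perm (Fin 3) := Equiv.refl _
noncomputable def p321 : Equiv.Perm (Fin 3) := Equiv.ofBijective ![2, 1, 0] (by decide)
noncomputable def p231 : Equiv.Perm (Fin 3) := Equiv.ofBijective ![1, 2, 0] (by decide)
noncomputable def p213 : Equiv.Perm (Fin 3) := Equiv.ofBijective ![1, 0, 2] (by decide)
noncomputable def p312 : Equiv.Perm (Fin 3) := Equiv.ofBijective ![2, 0, 1] (by decide)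
noncomputable def p132 : Equiv.Perm (Fin 3) := Equiv.ofBijective ![0, 2, 1] (by decide)

/-- `π` contains the length-3 pattern `σ`. -/
def ContainsPat {n : ℕ} (π : Equiv.Perm (Fin n)) (σ : Equiv.Perm (Fin 3)) : Prop :=
  ∃ f : Fin 3 → Fin n, StrictMono f ∧ ∀ j k : Fin 3, σ j < σ k ↔ π (f j) < π (f k)

/-- `π` avoids the length-3 pattern `σ`. -/
def AvoidsPat {n : ℕ} (π : Equiv.Perm (Fin n)) (σ : Equiv.Perm (Fin 3)) : Prop :=
  ¬ ContainsPat π σ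

/-- Trees with `n+1` vertices. -/
def TreeN (n : ℕ) : Type := {t : Set Vertex // IsTree t ∧ t.encard = (n : ℕ∞) + 1}

/-- Embedding of a permutation of `[n]` into `F(ℕ, ℕ*)` by `π(k) = k` for `k > n`
(permutations are `1`-indexed: position `k ∈ [1, n]` corresponds to `k - 1 : Fin n`). -/
noncomputable def embedPerm {n : ℕ} (π : Equiv.Perm (Fin n)) : ℕ → ℕ∞ := fun k =>
  if h : 1 ≤ k ∧ k ≤ n then (((π ⟨k - 1, by omega⟩ : Fin n) : ℕ) + 1 : ℕ) else (k : ℕ∞)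

/-- The (finite) set of permutations of `[n]` avoiding `σ`. -/
noncomputable def avoidFinset (σ : Equiv.Perm (Fin 3)) (n : ℕ) : Finset (Equiv.Perm (Fin n)) :=
  Set.Finite.toFinset (Set.toFinite {π : Equiv.Perm (Fin n) | AvoidsPat π σ})

/-- The law of a uniformly random `σ`-avoiding permutation of `[n]`,
as a measure on `F(ℕ, ℕ*)`. -/
noncomputable def uniformAvoidLaw (σ : Equiv.Perm (Fin 3)) (n : ℕ) : Measure (ℕ → ℕ∞) :=
  ((avoidFinset σ n).card : ℝ≥0∞)⁻¹ • ∑ π ∈ avoidFinset σ n, Measure.dirac (embedPerm π)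


open Classical in
/-- `Φ^σ` for an arbitrary pattern `σ ∈ S_3`, given a tree together with its increasing
vertex enumeration `v`, its decreasing vertex enumeration `w`, and the increasing
enumeration `l` of the relevant set `Lset` of leaves. -/
noncomputable def PhiOf (σ : Equiv.Perm (Fin 3)) (t : Set Vertex)
    (v w l : ℕ → Vertex) (Lset : Set Vertex) : ℕ → ℕ∞ :=
  if σ = p231 then phi231 t v
  else if σ = p213 then phi213 t v
  else if σ = p312 then phi312 t w
  else if σ = p132 then phi132 t w
  else if σ = p321 then phi321Fun (sVal t l) (pVal l) Lset.encard
  else phi123Fun t.encard (phi321Fun (sVal t l) (pVal l) Lset.encard)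

open Classical in
noncomputable def canonSpine (t : Set Vertex) : ℕ → Vertex :=
  if h : ∃ η : ℕ → Vertex, IsSpine t η then h.choose else fun _ => []

open Classical in
noncomputable def canonV (t : Set Vertex) : ℕ → Vertex :=
  if h : ∃ v : ℕ → Vertex, IsLexEnum t v then h.choose else fun _ => []

open Classical in
noncomputable def canonW (t : Set Vertex) : ℕ → Vertex :=
  if h : ∃ w : ℕ → Vertex, IsLexCoEnum t w then h.choose else fun _ => []

open Classical in
noncomputable def canonL (t : Set Vertex) : ℕ → Vertex :=
  if h : ∃ l : ℕ → Vertex, IsEnumOf (leftLeaves t (canonSpine t)) l then h.choose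
  else fun _ => []

/-- `Φ^σ_t` for an infinite tree `t ∈ 𝔗_∞`, using the canonical (unique) spine and
enumerations. -/
noncomputable def PhiCanon (σ : Equiv.Perm (Fin 3)) (t : Set Vertex) : ℕ → ℕ∞ :=
  PhiOf σ t (canonV t) (canonW t) (canonL t) (leftLeaves t (canonSpine t))

/-- σ-algebra on the space of trees: all sets are measurable. -/
instance : MeasurableSpace (Set Vertex) := ⊤

/-- `μ` is the law of a Galton–Watson tree with offspring distribution `ξ`:
a probability measure, supported on trees, giving each finite tree `t` the
probability `∏_{u ∈ t} ξ(d_t(u))`. -/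
def IsGW (ξ : ℕ → ℝ≥0∞) (μ : Measure (Set Vertex)) : Prop :=
  IsProbabilityMeasure μ ∧ μ {t | IsTree t} = 1 ∧
    ∀ t : Set Vertex, IsTree t → ∀ ht : t.Finite,
      μ {t} = ∏ u ∈ ht.toFinset, ξ (childCount t u)

/-- `π` is the permutation `Φ^{321}_t` of `[n]` associated to a finite tree `t` with
`n+1` vertices: for every leaf `v` with `s = #{x ∈ t : x < v}` and `p = |v|`, position
`s - p + 1` is mapped to `s` (in 0-indexed form: position `s - p` to value `s - 1`),
and `π` is increasing on the remaining positions. -/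
def Is321Image (n : ℕ) (t : Set Vertex) (π : Equiv.Perm (Fin n)) : Prop :=
  (∀ v : Vertex, IsLeaf t v →
    ∃ hb : {x ∈ t | x < v}.ncard - v.length < n,
      ((π ⟨{x ∈ t | x < v}.ncard - v.length, hb⟩ : Fin n) : ℕ)
        = {x ∈ t | x < v}.ncard - 1) ∧
  ∀ a b : Fin n, a < b →
    (∀ v : Vertex, IsLeaf t v → {x ∈ t | x < v}.ncard - v.length ≠ (a : ℕ)) →
    (∀ v : Vertex, IsLeaf t v → {x ∈ t | x < v}.ncard - v.length ≠ (b : ℕ)) →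
    π a < π b

/-- `π` is the permutation `Φ^{123}_t = (n+1) - Φ^{321}_t` of `[n]`. -/
def Is123Image (n : ℕ) (t : Set Vertex) (π : Equiv.Perm (Fin n)) : Prop :=
  ∃ π' : Equiv.Perm (Fin n), Is321Image n t π' ∧ ∀ i : Fin n, π i = Fin.rev (π' i)


/-! ## Lists ordered lexicographically -/

/-- The vertex `u` with all its child indices reversed in order: comparing mirrors
lexicographically compares vertices in the right-to-left depth-first order. -/
def mirror (u : Vertex) : List ℕᵒᵈ := u.map OrderDual.toDual

lemma mirror_injective : Function.Injective mirror :=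
  List.map_injective_iff.2 OrderDual.toDual.injective

lemma mirror_lt_mirror_iff (x y : Vertex) :
    mirror x < mirror y ↔ (x <+: y ∧ x ≠ y) ∨ (y < x ∧ ¬ y <+: x) := by
  induction x generalizing y with
  | nil => cases y <;> simp [mirror]
  | cons a x ih =>
    cases y with
    | nil => simp [mirror]
    | cons b y =>
      have := ih y
      simp only [mirror, List.map_cons, List.cons_lt_cons_iff, List.cons_prefix_cons,
        OrderDual.toDual_lt_toDual, OrderDual.toDual_inj, ne_eq, List.cons.injEq] at this ⊢
      rw [this]
      rcases lt_trichotomy a b with h | h | h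
      · simp [h.ne, h.ne', h.not_gt]
      · simp [h]
      · simp [h.ne, h.ne', h]

lemma le_of_prefix {x y : Vertex} (h : x <+: y) : x ≤ y := by
  obtain ⟨z, rfl⟩ := h
  exact not_lt.1 (List.le_append_left (α := ℕ))

lemma exists_append_of_not_lt_of_lt {p u : Vertex} {c : ℕ} (hp : ¬ u < p) (hu : u < p ++ [c]) :
    ∃ r : Vertex, u = p ++ r ∧ r < [c] := by
  induction p generalizing u with
  | nil => exact ⟨u, rfl, hu⟩
  | cons a p ih =>
    cases u with
    | nil => simp at hp
    | cons b u =>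
      rw [List.cons_append, List.cons_lt_cons_iff] at hu
      rw [List.cons_lt_cons_iff] at hp
      obtain ⟨rfl, h⟩ : b = a ∧ u < p ++ [c] := hu.resolve_left fun h => hp (Or.inl h)
      obtain ⟨r, rfl, hr⟩ := ih (fun h' => hp (Or.inr ⟨rfl, h'⟩)) h
      exact ⟨r, rfl, hr⟩

/-- The vertex of height `h + 1` following `u` in depth-first order, for `h ≤ |u|`. -/
def nextVertex (u : Vertex) (h : ℕ) : Vertex := u.take h ++ [(u.map (· + 1)).getD h 0]

lemma length_nextVertex {u : Vertex} {h : ℕ} (hh : h ≤ u.length) :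
    (nextVertex u h).length = h + 1 := by
  simp [nextVertex, hh]

lemma nextVertex_length (u : Vertex) : nextVertex u u.length = u ++ [0] := by
  simp [nextVertex]

lemma nextVertex_append_cons (p s : Vertex) (d : ℕ) :
    nextVertex (p ++ d :: s) p.length = p ++ [d + 1] := by
  simp [nextVertex]

lemma eq_or_exists_eq_append_cons {u : Vertex} {h : ℕ} (hh : h ≤ u.length) :
    h = u.length ∨ ∃ p d s, u = p ++ d :: s ∧ h = p.length := by
  rcases hh.eq_or_lt with h' | h'
  · exact Or.inl h'
  · exact Or.inr ⟨u.take h, u[h], u.drop (h + 1), by simp, by simp [h'.le]⟩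

lemma lt_nextVertex {u : Vertex} {h : ℕ} (hh : h ≤ u.length) : u < nextVertex u h := by
  rcases eq_or_exists_eq_append_cons hh with rfl | ⟨p, d, s, rfl, rfl⟩
  · rw [nextVertex_length]
    simpa using List.append_left_lt (l₁ := u) (List.nil_lt_cons 0 [])
  · rw [nextVertex_append_cons]
    exact List.append_left_lt (by simp [List.cons_lt_cons_iff])

lemma eq_nextVertex_of_covering {t : Set Vertex} (ht : IsTree t) {u x : Vertex} (hu : u ∈ t)
    (hx : x ∈ t) (hux : u < x) (hcov : ∀ y ∈ t, y < x → ¬ u < y) :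
    x = nextVertex u (x.length - 1) := by
  rcases List.eq_nil_or_concat' x with rfl | ⟨p, c, rfl⟩
  · exact absurd hux (List.not_lt_nil u)
  have hpx : p < p ++ [c] := by
    simpa using List.append_left_lt (l₁ := p) (List.nil_lt_cons c [])
  obtain ⟨r, rfl, hr⟩ := exists_append_of_not_lt_of_lt (hcov p (ht.2.1 p [c] hx) hpx) hux
  have key : ∀ j < c, ¬ r < [j] := fun j hj hlt =>
    hcov _ (ht.2.2 p c j hx hj.le) (List.append_left_lt (by simp [List.cons_lt_cons_iff, hj]))
      (List.append_left_lt hlt)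
  cases r with
  | nil =>
    obtain rfl : c = 0 := by
      by_contra hc
      exact key 0 (Nat.pos_of_ne_zero hc) (List.nil_lt_cons 0 [])
    simp [nextVertex]
  | cons d s =>
    have hdc : d < c := by simpa [List.cons_lt_cons_iff] using hr
    obtain rfl : c = d + 1 := by
      by_contra hc
      exact key (d + 1) (by omega) (by simp [List.cons_lt_cons_iff])
    simp [nextVertex]

/-! ## Rank permutations and inversion codes -/

section Rank

variable {α : Type*} [LinearOrder α] {n : ℕ}

/-- The number of indices whose value under `g` is less than that of `i`. -/
def rank (g : Fin n → α) (i : Fin n) : ℕ := (Finset.univ.filter fun j => g j < g i).card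

lemma rank_lt_rank_iff (g : Fin n → α) (i j : Fin n) : rank g i < rank g j ↔ g i < g j := by
  have mono : ∀ {i j}, g i ≤ g j → rank g i ≤ rank g j := fun {i j} h =>
    Finset.card_le_card fun k hk => by
      simp only [Finset.mem_filter, Finset.mem_univ, true_and] at hk ⊢
      exact hk.trans_le h
  refine ⟨fun h => ?_, fun h => Finset.card_lt_card ⟨fun k hk => ?_, fun hsub => ?_⟩⟩
  · by_contra hle
    exact absurd (mono (not_lt.1 hle)) (not_le.2 h)
  · simp only [Finset.mem_filter, Finset.mem_univ, true_and] at hk ⊢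
    exact hk.trans h
  · have : i ∈ Finset.univ.filter fun k => g k < g i := hsub (by simpa using h)
    simp at this

lemma rank_lt (g : Fin n → α) (i : Fin n) : rank g i < n := by
  have : rank g i < (Finset.univ : Finset (Fin n)).card :=
    Finset.card_lt_card (Finset.filter_ssubset.2 ⟨i, Finset.mem_univ i, lt_irrefl _⟩)
  simpa using this

/-- The permutation sending each index to the rank of its value under `g`. -/
noncomputable def rankPerm (g : Fin n → α) (hg : Function.Injective g) : Equiv.Perm (Fin n) :=
  Equiv.ofBijective (fun i => ⟨rank g i, rank_lt g i⟩) <| Finite.injective_iff_bijective.1 <| by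
    intro i j hij
    have h : rank g i = rank g j := congrArg Fin.val hij
    refine hg (le_antisymm ?_ ?_) <;> refine not_lt.1 fun hlt => ?_
    · exact ((rank_lt_rank_iff g j i).2 hlt).ne' h
    · exact ((rank_lt_rank_iff g i j).2 hlt).ne h

lemma coe_rankPerm (g : Fin n → α) (hg : Function.Injective g) (i : Fin n) :
    (rankPerm g hg i : ℕ) = rank g i := rfl

lemma rankPerm_lt_iff (g : Fin n → α) (hg : Function.Injective g) (i j : Fin n) :
    rankPerm g hg i < rankPerm g hg j ↔ g i < g j := rank_lt_rank_iff g i j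

end Rank

/-- The inversion code of `π`: the number of later positions with a smaller value. -/
def invCode {n : ℕ} (π : Equiv.Perm (Fin n)) (i : Fin n) : ℕ :=
  (Finset.univ.filter fun j => i < j ∧ π j < π i).card

lemma invCode_eq_card_values {n : ℕ} (π : Equiv.Perm (Fin n)) (i : Fin n) :
    invCode π i = (Finset.univ.filter fun s => s < π i ∧ ∀ j < i, π j ≠ s).card := by
  rw [invCode, ← Finset.card_map π.toEmbedding]
  congr 1
  ext s
  simp only [Finset.mem_map_equiv, Finset.mem_filter, Finset.mem_univ, true_and,
    Equiv.apply_symm_apply]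
  constructor
  · rintro ⟨h1, h2⟩
    refine ⟨h2, fun j hj hjs => ?_⟩
    rw [← hjs, Equiv.symm_apply_apply] at h1
    exact lt_asymm h1 hj
  · rintro ⟨h1, h2⟩
    refine ⟨?_, h1⟩
    by_contra hle
    rcases (not_lt.1 hle).eq_or_lt with h | h
    · rw [← h] at h1
      simp at h1
    · exact h2 _ h (by simp)

lemma invCode_injective {n : ℕ} : Function.Injective (invCode (n := n)) := by
  have key : ∀ (σ τ : Equiv.Perm (Fin n)) (i : Fin n), (∀ j < i, σ j = τ j) →
      σ i < τ i → invCode σ i < invCode τ i := by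
    intro σ τ i h hlt
    rw [invCode_eq_card_values, invCode_eq_card_values]
    refine Finset.card_lt_card ⟨fun s hs => ?_, fun hsub => ?_⟩
    · simp only [Finset.mem_filter, Finset.mem_univ, true_and] at hs ⊢
      exact ⟨hs.1.trans hlt, fun j hj => h j hj ▸ hs.2 j hj⟩
    · have hmem : σ i ∈ Finset.univ.filter fun s => s < τ i ∧ ∀ j < i, τ j ≠ s := by
        simp only [Finset.mem_filter, Finset.mem_univ, true_and]
        exact ⟨hlt, fun j hj hjs => hj.ne (σ.injective ((h j hj).trans hjs))⟩
      have := hsub hmem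
      simp at this
  intro σ τ h
  ext1 i
  induction i using WellFoundedLT.induction with
  | ind i ih =>
    rcases lt_trichotomy (σ i) (τ i) with hlt | heq | hlt
    · exact absurd (congrFun h i) (key σ τ i ih hlt).ne
    · exact heq
    · exact absurd (congrFun h i) (key τ σ i (fun j hj => (ih j hj).symm) hlt).ne'

lemma containsPat_312_iff {n : ℕ} (π : Equiv.Perm (Fin n)) :
    ContainsPat π p312 ↔ ∃ i j k : Fin n, i < j ∧ j < k ∧ π j < π k ∧ π k < π i := by
  constructor
  · rintro ⟨f, hf, h⟩
    exact ⟨f 0, f 1, f 2, hf (by decide), hf (by decide), (h 1 2).1 (by simp [p312]),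
      (h 2 0).1 (by simp [p312])⟩
  · rintro ⟨i, j, k, hij, hjk, h1, h2⟩
    refine ⟨![i, j, k], ?_, ?_⟩
    · intro a b hab
      fin_cases a <;> fin_cases b <;> simp_all [hij.trans hjk]
    · intro a b
      have h3 := h1.trans h2
      fin_cases a <;> fin_cases b <;>
        simp [p312, h1, h2, h3, h1.le, h2.le, h3.le]

/-! ## Enumerations of a tree -/

section Enum

variable {n : ℕ} {t : Set Vertex} {v : ℕ → Vertex}

lemma exists_isLexEnum (hc : t.encard = (n : ℕ∞) + 1) : ∃ v : ℕ → Vertex, IsLexEnum t v := by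
  have hfin : t.Finite := Set.finite_of_encard_eq_coe (k := n + 1) (by simpa using hc)
  have hcard : hfin.toFinset.card = n + 1 := by
    have := hfin.encard_eq_coe_toFinset_card
    rw [hc] at this
    exact_mod_cast this.symm
  let e := hfin.toFinset.orderIsoOfFin hcard
  refine ⟨fun i => if h : i < n + 1 then (e ⟨i, h⟩ : Vertex) else [], fun i hi => ?_⟩
  have hi' : i < n + 1 := by
    rw [hc] at hi
    exact_mod_cast hi
  simp only [hi', dite_true]
  refine ⟨hfin.mem_toFinset.1 (e ⟨i, hi'⟩).2, ?_⟩
  ext x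
  simp only [Set.mem_ofPred_eq, Set.mem_image]
  constructor
  · rintro ⟨hx, hlt⟩
    obtain ⟨⟨j, hj⟩, hje⟩ := e.surjective ⟨x, by simpa using hx⟩
    have hjx : (e ⟨j, hj⟩ : Vertex) = x := congrArg Subtype.val hje
    refine ⟨j, ?_, by simp [hj, hjx]⟩
    rw [← hjx] at hlt
    have : e ⟨j, hj⟩ < e ⟨i, hi'⟩ := hlt
    simpa using this
  · rintro ⟨j, hj, rfl⟩
    have hj' : j < n + 1 := hj.trans hi'
    simp only [hj', dite_true]
    refine ⟨hfin.mem_toFinset.1 (e ⟨j, hj'⟩).2, ?_⟩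
    have : e ⟨j, hj'⟩ < e ⟨i, hi'⟩ := by simpa using hj
    exact this

lemma IsLexEnum.mem (hv : IsLexEnum t v) (hc : t.encard = (n : ℕ∞) + 1) {k : ℕ} (hk : k ≤ n) :
    v k ∈ t :=
  (hv k (by rw [hc]; exact_mod_cast Nat.lt_succ_of_le hk)).1

lemma IsLexEnum.strictMonoOn (hv : IsLexEnum t v) (hc : t.encard = (n : ℕ∞) + 1) :
    StrictMonoOn v (Set.Iic n) := by
  intro j _ k hk hjk
  have h := (hv k (by rw [hc]; exact_mod_cast Nat.lt_succ_of_le hk)).2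
  have : v j ∈ {x ∈ t | x < v k} := h ▸ Set.mem_image_of_mem v hjk
  exact this.2

lemma IsLexEnum.image_eq (hv : IsLexEnum t v) (hc : t.encard = (n : ℕ∞) + 1) :
    v '' Set.Iic n = t := by
  have hfin : t.Finite := Set.finite_of_encard_eq_coe (k := n + 1) (by simpa using hc)
  refine hfin.eq_of_subset_of_encard_le' ?_ ?_
  · rintro _ ⟨k, hk, rfl⟩
    exact hv.mem hc hk
  · rw [hc, (hv.strictMonoOn hc).injOn.encard_image, ← Finset.coe_Iic,
      Set.encard_coe_eq_coe_finsetCard]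
    simp

lemma IsLexEnum.exists_eq (hv : IsLexEnum t v) (hc : t.encard = (n : ℕ∞) + 1) {x : Vertex}
    (hx : x ∈ t) : ∃ k ≤ n, v k = x := by
  rw [← hv.image_eq hc] at hx
  exact hx

lemma IsLexEnum.zero_eq (hv : IsLexEnum t v) (hc : t.encard = (n : ℕ∞) + 1) (ht : IsTree t) :
    v 0 = [] := by
  obtain ⟨k, hk, hk0⟩ := hv.exists_eq hc ht.1
  rcases Nat.eq_zero_or_pos k with rfl | hpos
  · exact hk0
  · have := hv.strictMonoOn hc (Nat.zero_le n) hk hpos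
    rw [hk0] at this
    exact absurd this (List.not_lt_nil _)

lemma IsLexEnum.succ_eq (hv : IsLexEnum t v) (hc : t.encard = (n : ℕ∞) + 1) (ht : IsTree t)
    {k : ℕ} (hk : k < n) : v (k + 1) = nextVertex (v k) ((v (k + 1)).length - 1) := by
  refine eq_nextVertex_of_covering ht (hv.mem hc hk.le) (hv.mem hc hk)
    (hv.strictMonoOn hc (Set.mem_Iic.2 hk.le) (Set.mem_Iic.2 hk) k.lt_succ_self) ?_
  intro y hy hlt
  obtain ⟨j, hj, rfl⟩ := hv.exists_eq hc hy
  have h : j < k + 1 := ((hv.strictMonoOn hc).lt_iff_lt hj (Set.mem_Iic.2 hk)).1 hlt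
  exact (((hv.strictMonoOn hc).le_iff_le hj (Set.mem_Iic.2 hk.le)).2 (Nat.lt_succ_iff.1 h)).not_gt

/-- A tree is determined by the heights of its vertices in depth-first order. -/
lemma eq_of_length_eq {t' : Set Vertex} {v' : ℕ → Vertex} (ht : IsTree t)
    (hc : t.encard = (n : ℕ∞) + 1) (hv : IsLexEnum t v) (ht' : IsTree t')
    (hc' : t'.encard = (n : ℕ∞) + 1) (hv' : IsLexEnum t' v')
    (h : ∀ k < n, (v (k + 1)).length = (v' (k + 1)).length) : t = t' := by
  have key : ∀ k ≤ n, v k = v' k := by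
    intro k
    induction k with
    | zero => intro; rw [hv.zero_eq hc ht, hv'.zero_eq hc' ht']
    | succ k ih =>
      intro hk
      rw [hv.succ_eq hc ht hk, hv'.succ_eq hc' ht' hk, ih (by omega), h k hk]
  rw [← hv.image_eq hc, ← hv'.image_eq hc']
  exact Set.image_congr key

end Enum

/-! ## The permutation of a tree -/

section TreePerm

variable {n : ℕ} {t : Set Vertex} {v : ℕ → Vertex}

/-- The non-root vertices in decreasing lexicographic order. -/
def revEnum (n : ℕ) (v : ℕ → Vertex) (i : Fin n) : Vertex := v (n - i)

lemma revEnum_strictAnti (hv : IsLexEnum t v) (hc : t.encard = (n : ℕ∞) + 1) :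
    StrictAnti (revEnum n v) := fun i j hij =>
  hv.strictMonoOn hc (Set.mem_Iic.2 (Nat.sub_le ..)) (Set.mem_Iic.2 (Nat.sub_le ..))
    (by have := j.2; have : (i : ℕ) < j := hij; omega)

lemma revEnum_mem (hv : IsLexEnum t v) (hc : t.encard = (n : ℕ∞) + 1) (i : Fin n) :
    revEnum n v i ∈ t := hv.mem hc (Nat.sub_le ..)

lemma revEnum_ne_nil (hv : IsLexEnum t v) (hc : t.encard = (n : ℕ∞) + 1) (i : Fin n) :
    revEnum n v i ≠ [] := by
  intro h
  have := hv.strictMonoOn hc (Nat.zero_le n) (Set.mem_Iic.2 (Nat.sub_le n i))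
    (Nat.sub_pos_of_lt i.2)
  change v 0 < revEnum n v i at this
  rw [h] at this
  exact List.not_lt_nil _ this

lemma exists_revEnum_eq (hv : IsLexEnum t v) (hc : t.encard = (n : ℕ∞) + 1) (ht : IsTree t)
    {x : Vertex} (hx : x ∈ t) (hx0 : x ≠ []) : ∃ i, revEnum n v i = x := by
  obtain ⟨k, hk, rfl⟩ := hv.exists_eq hc hx
  have hk0 : k ≠ 0 := by
    rintro rfl
    exact hx0 (hv.zero_eq hc ht)
  exact ⟨⟨n - k, by omega⟩, congrArg v (Nat.sub_sub_self hk)⟩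

lemma card_prefix_revEnum (hv : IsLexEnum t v) (hc : t.encard = (n : ℕ∞) + 1) (ht : IsTree t)
    (i : Fin n) :
    (Finset.univ.filter fun j => revEnum n v j <+: revEnum n v i).card
      = (revEnum n v i).length := by
  have hcard : (Finset.Icc 1 (revEnum n v i).length).card = (revEnum n v i).length := by simp
  rw [← hcard]
  refine Finset.card_nbij (fun j => (revEnum n v j).length) ?_ ?_ ?_
  · intro j hj
    simp only [Finset.mem_coe, Finset.mem_filter, Finset.mem_univ, true_and] at hj
    simp only [Finset.mem_coe, Finset.mem_Icc]
    exact ⟨List.length_pos_iff.2 (revEnum_ne_nil hv hc j), hj.length_le⟩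
  · intro j hj k hk hjk
    simp only [Finset.mem_coe, Finset.mem_filter, Finset.mem_univ, true_and] at hj hk
    exact (revEnum_strictAnti hv hc).injective
      ((List.prefix_of_prefix_length_le hj hk hjk.le).eq_of_length hjk)
  · intro m hm
    simp only [Finset.mem_coe, Finset.mem_Icc] at hm
    have hlen : ((revEnum n v i).take m).length = m := by simp [hm.2]
    obtain ⟨j, hj⟩ := exists_revEnum_eq hv hc ht
      (ht.2.1 ((revEnum n v i).take m) ((revEnum n v i).drop m)
        (by rw [List.take_append_drop]; exact revEnum_mem hv hc i))
      (fun h => by rw [h] at hlen; simp at hlen; omega)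
    refine ⟨j, ?_, by simp only [hj, hlen]⟩
    simp only [Finset.mem_coe, Finset.mem_filter, Finset.mem_univ, true_and, hj]
    exact List.take_prefix _ _

lemma encard_fringe_revEnum (hv : IsLexEnum t v) (hc : t.encard = (n : ℕ∞) + 1) (ht : IsTree t)
    (i : Fin n) :
    (fringe t (revEnum n v i)).encard
      = ((Finset.univ.filter fun j => revEnum n v i <+: revEnum n v j).card : ℕ∞) := by
  rw [← Set.encard_coe_eq_coe_finsetCard,
    ← (revEnum_strictAnti hv hc).injective.encard_image]
  congr 1
  ext x
  simp only [fringe, Set.mem_ofPred_eq, Finset.coe_filter, Finset.mem_univ, true_and,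
    Set.mem_image]
  constructor
  · rintro ⟨hx, hpre⟩
    obtain ⟨j, rfl⟩ := exists_revEnum_eq hv hc ht hx (fun h => by
      rw [h, List.prefix_nil] at hpre
      exact revEnum_ne_nil hv hc i hpre)
    exact ⟨j, hpre, rfl⟩
  · rintro ⟨j, hpre, rfl⟩
    exact ⟨revEnum_mem hv hc j, hpre⟩

lemma mirror_revEnum_injective (hv : IsLexEnum t v) (hc : t.encard = (n : ℕ∞) + 1) :
    Function.Injective fun i : Fin n => mirror (revEnum n v i) :=
  mirror_injective.comp (revEnum_strictAnti hv hc).injective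

lemma rank_mirror_add_card_fringe (hv : IsLexEnum t v) (hc : t.encard = (n : ℕ∞) + 1)
    (ht : IsTree t) (i : Fin n) :
    rank (fun i : Fin n => mirror (revEnum n v i)) i + 1
        + (Finset.univ.filter fun j => revEnum n v i <+: revEnum n v j).card
      = i + 1 + (revEnum n v i).length := by
  classical
  set w := revEnum n v with hw
  have hanti : StrictAnti w := revEnum_strictAnti hv hc
  have hrank : rank (fun i : Fin n => mirror (w i)) i + 1
      = (Finset.univ.filter fun j => w j <+: w i).card
        + (Finset.univ.filter fun j => w i < w j ∧ ¬ w i <+: w j).card := by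
    rw [rank, ← Finset.card_insert_of_notMem (a := i) (by simp), ← Finset.card_union_of_disjoint]
    · congr 1
      ext j
      simp only [Finset.mem_insert, Finset.mem_filter, Finset.mem_univ, true_and,
        Finset.mem_union, mirror_lt_mirror_iff, ne_eq, hanti.injective.eq_iff]
      by_cases hji : j = i
      · simp [hji]
      · simp [hji]
    · rw [Finset.disjoint_filter]
      exact fun j _ h1 h2 => (le_of_prefix h1).not_gt h2.1
  have hge : (Finset.univ.filter fun j => w i < w j ∧ ¬ w i <+: w j).card
      + (Finset.univ.filter fun j => w i <+: w j).card = i + 1 := by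
    have hIic : (Finset.Iic i).card = (i : ℕ) + 1 := by simp
    rw [← hIic, ← Finset.card_union_of_disjoint]
    · congr 1
      ext j
      simp only [Finset.mem_union, Finset.mem_filter, Finset.mem_univ, true_and, Finset.mem_Iic,
        hanti.lt_iff_gt]
      constructor
      · rintro (h | h)
        · exact h.1.le
        · exact hanti.le_iff_ge.1 (le_of_prefix h)
      · intro h
        by_cases hp : w i <+: w j
        · exact Or.inr hp
        · refine Or.inl ⟨lt_of_le_of_ne h ?_, hp⟩
          rintro rfl
          exact hp List.prefix_rfl
    · rw [Finset.disjoint_filter]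
      exact fun j _ h1 h2 => h1.2 h2
  have hpre := card_prefix_revEnum hv hc ht i
  rw [← hw] at hpre
  omega

lemma phi312_eq (hv : IsLexEnum t v) (hc : t.encard = (n : ℕ∞) + 1) (ht : IsTree t)
    (i : Fin n) :
    phi312 t (fun j => v (n - j)) ((i : ℕ) + 1)
      = ((rankPerm _ (mirror_revEnum_injective hv hc) i + 1 : ℕ) : ℕ∞) := by
  have hi : 1 ≤ (i : ℕ) + 1 ∧ (((i : ℕ) + 1 : ℕ) : ℕ∞) < t.encard := by
    refine ⟨by omega, ?_⟩
    rw [hc]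
    exact_mod_cast Nat.succ_lt_succ i.2
  rw [phi312, if_pos hi, Nat.add_sub_cancel]
  change _ + ((revEnum n v i).length : ℕ∞) - (fringe t (revEnum n v i)).encard = _
  rw [encard_fringe_revEnum hv hc ht, ← Nat.cast_add, ← rank_mirror_add_card_fringe hv hc ht,
    ← ENat.natCast_sub, Nat.add_sub_cancel, coe_rankPerm]

/-- Inversions of the permutation of a tree are the strict ancestor pairs. -/
lemma rankPerm_mirror_lt_iff (hv : IsLexEnum t v) (hc : t.encard = (n : ℕ∞) + 1)
    {i j : Fin n} (hij : i < j) :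
    rankPerm _ (mirror_revEnum_injective hv hc) j < rankPerm _ (mirror_revEnum_injective hv hc) i
      ↔ revEnum n v j <+: revEnum n v i := by
  have hlt := revEnum_strictAnti hv hc hij
  rw [rankPerm_lt_iff, mirror_lt_mirror_iff]
  constructor
  · rintro (h | h)
    · exact h.1
    · exact absurd h.1 hlt.not_gt
  · exact fun h => Or.inl ⟨h, hlt.ne⟩

lemma avoidsPat_rankPerm_mirror (hv : IsLexEnum t v) (hc : t.encard = (n : ℕ∞) + 1) :
    AvoidsPat (rankPerm _ (mirror_revEnum_injective hv hc)) p312 := by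
  rw [AvoidsPat, containsPat_312_iff]
  rintro ⟨i, j, k, hij, hjk, h1, h2⟩
  have hj := (rankPerm_mirror_lt_iff hv hc hij).1 (h1.trans h2)
  have hk := (rankPerm_mirror_lt_iff hv hc (hij.trans hjk)).1 h2
  refine h1.not_gt ((rankPerm_mirror_lt_iff hv hc hjk).2 ?_)
  rcases List.prefix_or_prefix_of_prefix hj hk with h | h
  · exact absurd (revEnum_strictAnti hv hc hjk) (le_of_prefix h).not_gt
  · exact h

lemma length_revEnum_eq_invCode (hv : IsLexEnum t v) (hc : t.encard = (n : ℕ∞) + 1)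
    (ht : IsTree t) (i : Fin n) :
    (revEnum n v i).length = invCode (rankPerm _ (mirror_revEnum_injective hv hc)) i + 1 := by
  classical
  rw [invCode, ← card_prefix_revEnum hv hc ht, ← Finset.card_insert_of_notMem (a := i) (by simp)]
  congr 1
  ext j
  simp only [Finset.mem_insert, Finset.mem_filter, Finset.mem_univ, true_and]
  constructor
  · intro h
    rcases ((revEnum_strictAnti hv hc).le_iff_ge.1 (le_of_prefix h)).eq_or_lt with h' | h'
    · exact Or.inl h'.symm
    · exact Or.inr ⟨h', (rankPerm_mirror_lt_iff hv hc h').2 h⟩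
  · rintro (rfl | ⟨h1, h2⟩)
    · exact List.prefix_rfl
    · exact (rankPerm_mirror_lt_iff hv hc h1).1 h2

end TreePerm

/-! ## The tree with prescribed heights -/

/-- The sequence of vertices in depth-first order whose `k`-th non-root term has height
`h k + 1`. -/
def vertexSeq (h : ℕ → ℕ) : ℕ → Vertex
  | 0 => []
  | k + 1 => nextVertex (vertexSeq h k) (h k)

section VertexSeq

variable {h : ℕ → ℕ}

lemma le_length_vertexSeq (h0 : h 0 = 0) (hs : ∀ k, h (k + 1) ≤ h k + 1) (k : ℕ) :
    h k ≤ (vertexSeq h k).length := by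
  induction k with
  | zero => simp [h0]
  | succ k ih =>
    rw [vertexSeq, length_nextVertex ih]
    exact hs k

lemma length_vertexSeq_succ (h0 : h 0 = 0) (hs : ∀ k, h (k + 1) ≤ h k + 1) (k : ℕ) :
    (vertexSeq h (k + 1)).length = h k + 1 :=
  length_nextVertex (le_length_vertexSeq h0 hs k)

lemma vertexSeq_strictMono (h0 : h 0 = 0) (hs : ∀ k, h (k + 1) ≤ h k + 1) :
    StrictMono (vertexSeq h) :=
  strictMono_nat_of_lt_succ fun k => lt_nextVertex (le_length_vertexSeq h0 hs k)

lemma exists_vertexSeq_eq_of_prefix {k : ℕ} {x : Vertex} (hx : x <+: vertexSeq h k) :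
    ∃ j ≤ k, vertexSeq h j = x := by
  induction k with
  | zero => exact ⟨0, le_rfl, (List.prefix_nil.1 hx).symm⟩
  | succ k ih =>
    rw [vertexSeq, nextVertex, List.prefix_concat_iff] at hx
    rcases hx with hx | hx
    · exact ⟨k + 1, le_rfl, hx.symm⟩
    · obtain ⟨j, hj, hjx⟩ := ih (hx.trans (List.take_prefix _ _))
      exact ⟨j, by omega, hjx⟩

lemma exists_vertexSeq_eq_of_sibling (h0 : h 0 = 0) (hs : ∀ k, h (k + 1) ≤ h k + 1) {k : ℕ}
    {u : Vertex} {i j : ℕ} (hu : u ++ [i] <+: vertexSeq h k) (hji : j ≤ i) :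
    ∃ l ≤ k, vertexSeq h l = u ++ [j] := by
  induction k generalizing i with
  | zero => simp [vertexSeq] at hu
  | succ k ih =>
    by_cases hk : u ++ [i] <+: vertexSeq h k
    · obtain ⟨l, hl, hlu⟩ := ih hk hji
      exact ⟨l, by omega, hlu⟩
    rcases hji.eq_or_lt with rfl | hlt
    · exact exists_vertexSeq_eq_of_prefix hu
    have hlen := le_length_vertexSeq h0 hs k
    rw [vertexSeq, nextVertex, List.prefix_concat_iff] at hu
    rcases hu with hu | hu
    swap
    · exact absurd (hu.trans (List.take_prefix _ _)) hk
    change _ = nextVertex _ _ at hu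
    rcases eq_or_exists_eq_append_cons hlen with h' | ⟨p, d, s, hp, h'⟩
    · rw [h', nextVertex_length] at hu
      have := (List.append_inj' hu rfl).2
      simp only [List.cons.injEq, and_true] at this
      omega
    · rw [hp, h', nextVertex_append_cons] at hu
      obtain ⟨rfl, hi⟩ := List.append_inj' hu rfl
      simp only [List.cons.injEq, and_true] at hi
      have hpre : u ++ [d] <+: vertexSeq h k := ⟨s, by simp [hp]⟩
      obtain ⟨l, hl, hlu⟩ := ih hpre (by omega)
      exact ⟨l, by omega, hlu⟩

lemma isTree_image_vertexSeq (h0 : h 0 = 0) (hs : ∀ k, h (k + 1) ≤ h k + 1) (n : ℕ) :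
    IsTree (vertexSeq h '' Set.Iic n) := by
  refine ⟨⟨0, Nat.zero_le n, rfl⟩, ?_, ?_⟩
  · rintro u x ⟨k, hk, hkx⟩
    obtain ⟨j, hj, hju⟩ := exists_vertexSeq_eq_of_prefix (h := h) (k := k) ⟨x, hkx.symm⟩
    exact ⟨j, hj.trans hk, hju⟩
  · rintro u i j ⟨k, hk, hku⟩ hji
    obtain ⟨l, hl, hlu⟩ := exists_vertexSeq_eq_of_sibling h0 hs
      (hku ▸ List.prefix_rfl : u ++ [i] <+: vertexSeq h k) hji
    exact ⟨l, hl.trans hk, hlu⟩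

lemma encard_image_vertexSeq (h0 : h 0 = 0) (hs : ∀ k, h (k + 1) ≤ h k + 1) (n : ℕ) :
    (vertexSeq h '' Set.Iic n).encard = (n : ℕ∞) + 1 := by
  rw [(vertexSeq_strictMono h0 hs).injective.encard_image, ← Finset.coe_Iic,
    Set.encard_coe_eq_coe_finsetCard]
  simp

lemma isLexEnum_vertexSeq (h0 : h 0 = 0) (hs : ∀ k, h (k + 1) ≤ h k + 1) (n : ℕ) :
    IsLexEnum (vertexSeq h '' Set.Iic n) (vertexSeq h) := by
  intro i hi
  have hmono := vertexSeq_strictMono h0 hs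
  rw [encard_image_vertexSeq h0 hs] at hi
  have hin : i < n + 1 := by exact_mod_cast hi
  refine ⟨⟨i, Nat.lt_succ_iff.1 hin, rfl⟩, ?_⟩
  ext x
  constructor
  · rintro ⟨⟨k, hk, rfl⟩, hlt⟩
    exact ⟨k, hmono.lt_iff_lt.1 hlt, rfl⟩
  · rintro ⟨k, hk, rfl⟩
    exact ⟨⟨k, by simp only [Set.mem_ofPred_eq, Set.mem_Iic] at hk ⊢; omega, rfl⟩, hmono hk⟩

end VertexSeq

/-! ## Codes of permutations avoiding 312 -/

lemma invCode_le_of_avoidsPat {n : ℕ} {π : Equiv.Perm (Fin n)} (hπ : AvoidsPat π p312)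
    {i j : Fin n} (hij : (i : ℕ) + 1 = j) : invCode π i ≤ invCode π j + 1 := by
  classical
  rw [AvoidsPat, containsPat_312_iff] at hπ
  refine (Finset.card_le_card ?_).trans (Finset.card_insert_le j _)
  intro k hk
  simp only [Finset.mem_filter, Finset.mem_univ, true_and, Finset.mem_insert] at hk ⊢
  by_cases hkj : k = j
  · exact Or.inl hkj
  have hjk : j < k := by
    have h1 : (i : ℕ) < k := hk.1
    have h2 : (k : ℕ) ≠ j := fun h => hkj (Fin.ext h)
    exact Fin.lt_def.2 (by omega)
  refine Or.inr ⟨hjk, ?_⟩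
  by_contra hle
  exact hπ ⟨i, j, k, Fin.lt_def.2 (by omega), hjk,
    lt_of_le_of_ne (not_lt.1 hle) (π.injective.ne hjk.ne), hk.2⟩

/-- The inversion code read from the last position, extended by `0`. -/
def revCode {n : ℕ} (π : Equiv.Perm (Fin n)) (k : ℕ) : ℕ :=
  if hk : k < n then invCode π (Fin.rev ⟨k, hk⟩) else 0

lemma revCode_zero {n : ℕ} (π : Equiv.Perm (Fin n)) : revCode π 0 = 0 := by
  unfold revCode
  split_ifs with hn
  · rw [invCode, Finset.card_eq_zero, Finset.filter_eq_empty_iff]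
    rintro j - ⟨hj, -⟩
    have h1 := Fin.lt_def.1 hj
    have h2 := j.2
    simp only [Fin.val_rev] at h1
    omega
  · rfl

lemma revCode_succ_le {n : ℕ} {π : Equiv.Perm (Fin n)} (hπ : AvoidsPat π p312) (k : ℕ) :
    revCode π (k + 1) ≤ revCode π k + 1 := by
  by_cases hk : k + 1 < n
  · rw [revCode, revCode, dif_pos hk, dif_pos (by omega)]
    refine invCode_le_of_avoidsPat hπ ?_
    simp only [Fin.val_rev]
    omega
  · rw [revCode, dif_neg hk]
    exact Nat.zero_le _

/-- The map `t ↦ Φ_t^{312}`, `Φ_t^{312}(i) = i - |t_{w_i}| + |w_i|` with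
`w_i = v_{n+1-i}`, is a bijection from trees with `n+1` vertices onto `Av_n(312)`. -/
theorem bijection_312 (n : ℕ) :
    (∀ t : TreeN n, ∃ v : ℕ → Vertex, IsLexEnum t.1 v) ∧
    (∀ t : TreeN n, ∀ v : ℕ → Vertex, IsLexEnum t.1 v →
      ∃! π : Equiv.Perm (Fin n), ∀ i : Fin n,
        (((π i : ℕ) + 1 : ℕ) : ℕ∞) = phi312 t.1 (fun j : ℕ => v (n - j)) ((i : ℕ) + 1)) ∧
    (∀ Φ : TreeN n → Equiv.Perm (Fin n),
      (∀ t : TreeN n, ∀ v : ℕ → Vertex, IsLexEnum t.1 v → ∀ i : Fin n,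
        (((Φ t i : ℕ) + 1 : ℕ) : ℕ∞) = phi312 t.1 (fun j : ℕ => v (n - j)) ((i : ℕ) + 1)) →
      Set.BijOn Φ Set.univ {π : Equiv.Perm (Fin n) | AvoidsPat π p312}) := by
  have hcast : ∀ {a b : ℕ}, ((a + 1 : ℕ) : ℕ∞) = ((b + 1 : ℕ) : ℕ∞) → a = b := fun h => by
    have := ENat.natCast_inj.1 h
    omega
  refine ⟨fun t => exists_isLexEnum t.2.2, fun t v hv => ?_, fun Φ hΦ => ?_⟩
  · refine ⟨rankPerm _ (mirror_revEnum_injective hv t.2.2),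
      fun i => (phi312_eq hv t.2.2 t.2.1 i).symm, fun π hπ => ?_⟩
    ext i
    exact hcast ((hπ i).trans (phi312_eq hv t.2.2 t.2.1 i))
  have hΦeq : ∀ (t : TreeN n) (v : ℕ → Vertex) (hv : IsLexEnum t.1 v),
      Φ t = rankPerm _ (mirror_revEnum_injective hv t.2.2) := fun t v hv => by
    ext i
    exact hcast ((hΦ t v hv i).trans (phi312_eq hv t.2.2 t.2.1 i))
  have hlen : ∀ (t : TreeN n) (v : ℕ → Vertex), IsLexEnum t.1 v → ∀ i : Fin n,
      (revEnum n v i).length = invCode (Φ t) i + 1 := fun t v hv i => by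
    rw [hΦeq t v hv]
    exact length_revEnum_eq_invCode hv t.2.2 t.2.1 i
  refine ⟨fun t _ => ?_, fun t _ t' _ htt' => ?_, fun π hπ => ?_⟩
  · obtain ⟨v, hv⟩ := exists_isLexEnum t.2.2
    rw [hΦeq t v hv]
    exact avoidsPat_rankPerm_mirror hv t.2.2
  · obtain ⟨v, hv⟩ := exists_isLexEnum t.2.2
    obtain ⟨v', hv'⟩ := exists_isLexEnum t'.2.2
    refine Subtype.ext (eq_of_length_eq t.2.1 t.2.2 hv t'.2.1 t'.2.2 hv' fun k hk => ?_)
    have h := (hlen t v hv (Fin.rev ⟨k, hk⟩)).trans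
      ((congrArg (fun π => invCode π (Fin.rev ⟨k, hk⟩) + 1) htt').trans
        (hlen t' v' hv' (Fin.rev ⟨k, hk⟩)).symm)
    simpa only [revEnum, Fin.val_rev, Nat.sub_sub_self (Nat.succ_le_of_lt hk)] using h
  · have h0 := revCode_zero π
    have hs := revCode_succ_le hπ
    let t : TreeN n := ⟨vertexSeq (revCode π) '' Set.Iic n, isTree_image_vertexSeq h0 hs n,
      encard_image_vertexSeq h0 hs n⟩
    refine ⟨t, Set.mem_univ t, invCode_injective (funext fun i => ?_)⟩
    have h := hlen t _ (isLexEnum_vertexSeq h0 hs n) i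
    have hi : n - (i : ℕ) = (Fin.rev i : ℕ) + 1 := by
      have := i.2
      simp only [Fin.val_rev]
      omega
    rw [revEnum, hi, length_vertexSeq_succ h0 hs, revCode, dif_pos (Fin.rev i).2] at h
    simp only [Fin.eta, Fin.rev_rev] at h
    omega

end AvoidPaper
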